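/- Let H be a real Hilbert space, let v₁, …, v_N ∈ H satisfy ‖v_n‖ ≤ γ for all n, and let 1 ≤ M ≤ N. Let S be a uniformly random subset of {1, …, N} of size M, chosen without replacement. Then for every δ ∈ (0, 1), with probability at least 1 − δ, ‖Σ_{n=1}^N v_n − (N/M) Σ_{i ∈ S} v_i‖ ≤ √(8 γ² N (N − M + 1) / M) · √(2 log(2/δ)). -/

import Mathlib

open scoped Classical

/-- Jensen's inequality for the convex function `s ↦ cosh √s`, in a form free of square roots. -/
lemma cosh_le_of_sq_le_convexCombo {r p q t : ℝ} (ht0 : 0 ≤ t) (ht1 : t ≤ 1)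
    (h : r ^ 2 ≤ t * p ^ 2 + (1 - t) * q ^ 2) :
    Real.cosh r ≤ t * Real.cosh p + (1 - t) * Real.cosh q := by
  refine hasSum_le (fun n => ?_) (Real.hasSum_cosh r)
    (((Real.hasSum_cosh p).mul_left t).add ((Real.hasSum_cosh q).mul_left (1 - t)))
  have h1 : (r ^ 2) ^ n ≤ (t * p ^ 2 + (1 - t) * q ^ 2) ^ n :=
    pow_le_pow_left₀ (sq_nonneg r) h n
  have h2 := (convexOn_pow (𝕜 := ℝ) n).2 (Set.mem_Ici.2 (sq_nonneg p))
    (Set.mem_Ici.2 (sq_nonneg q)) ht0 (sub_nonneg.2 ht1) (by ring)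
  simp only [smul_eq_mul] at h2
  have h3 := h1.trans h2
  rw [pow_mul, pow_mul, pow_mul, ← mul_div_assoc, ← mul_div_assoc, ← add_div]
  gcongr

/-- A bounded perturbation changes `cosh ‖x‖` by at most a factor `cosh c`, up to a term which is
linear in the perturbation. -/
lemma cosh_norm_add_le {H : Type*} [NormedAddCommGroup H] [InnerProductSpace ℝ H]
    (x d : H) {c : ℝ} (hd : ‖d‖ ≤ c) :
    Real.cosh ‖x + d‖ ≤ Real.cosh ‖x‖ * Real.cosh c +
      Real.sinh ‖x‖ * Real.sinh c / (‖x‖ * c) * inner ℝ x d := by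
  have hc : 0 ≤ c := (norm_nonneg d).trans hd
  rcases (norm_nonneg x).eq_or_lt with hx | hx
  · have hx0 : x = 0 := norm_eq_zero.1 hx.symm
    subst hx0
    simpa [abs_of_nonneg hc] using hd
  rcases hc.eq_or_lt with hc0 | hc0
  · have hd0 : d = 0 := norm_le_zero_iff.1 (hc0 ▸ hd)
    subst hd0
    subst hc0
    simp
  set a := ‖x‖
  set w : ℝ := inner ℝ x d
  have hac : 0 < a * c := mul_pos hx hc0
  have hwabs : |w| ≤ a * c := (abs_real_inner_le_norm x d).trans (by gcongr)
  obtain ⟨hw1, hw2⟩ := abs_le.1 hwabs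
  have hu1 : -1 ≤ w / (a * c) := by rw [le_div_iff₀ hac]; linarith
  have hu2 : w / (a * c) ≤ 1 := by rw [div_le_iff₀ hac]; linarith
  have hwu : w = w / (a * c) * (a * c) := (div_mul_cancel₀ _ hac.ne').symm
  have hκ : Real.sinh a * Real.sinh c / (a * c) * w =
      Real.sinh a * Real.sinh c * (w / (a * c)) := by ring
  rw [hκ]
  have hn : ‖x + d‖ ^ 2 = a ^ 2 + 2 * w + ‖d‖ ^ 2 := norm_add_sq_real x d
  have hd2 : ‖d‖ ^ 2 ≤ c ^ 2 := by gcongr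
  set u := w / (a * c)
  have := cosh_le_of_sq_le_convexCombo (r := ‖x + d‖) (p := a + c) (q := a - c)
    (t := (1 + u) / 2) (by linarith) (by linarith) (by
      rw [hn, hwu]
      nlinarith)
  rw [Real.cosh_add, Real.cosh_sub] at this
  linarith

/-- Double counting of the pairs consisting of a `(k + 1)`-subset and one of its elements. -/
lemma sum_powersetCard_succ_sum_erase {ι : Type*} [Fintype ι] [DecidableEq ι] (k : ℕ)
    (F : Finset ι → ℝ) :
    ∑ T ∈ Finset.powersetCard (k + 1) Finset.univ, ∑ x ∈ T, F (T.erase x) =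
      ((Fintype.card ι - k : ℕ) : ℝ) * ∑ S ∈ Finset.powersetCard k Finset.univ, F S := by
  have h : ∀ S ∈ Finset.powersetCard k (Finset.univ : Finset ι),
      ((Fintype.card ι - k : ℕ) : ℝ) * F S = ∑ _x ∈ Sᶜ, F S := by
    intro S hS
    rw [Finset.sum_const, Finset.card_compl, (Finset.mem_powersetCard.1 hS).2, nsmul_eq_mul]
  rw [Finset.mul_sum, Finset.sum_congr rfl h, Finset.sum_sigma', Finset.sum_sigma']
  refine Finset.sum_bij' (fun p _ => ⟨p.1.erase p.2, p.2⟩) (fun p _ => ⟨insert p.2 p.1, p.2⟩)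
    ?_ ?_ ?_ ?_ ?_
  · rintro ⟨T, x⟩ hp
    simp only [Finset.mem_sigma, Finset.mem_powersetCard, Finset.subset_univ, true_and,
      Finset.mem_compl] at hp ⊢
    simp [Finset.card_erase_of_mem hp.2, hp.1]
  · rintro ⟨S, x⟩ hp
    simp only [Finset.mem_sigma, Finset.mem_powersetCard, Finset.subset_univ, true_and,
      Finset.mem_compl] at hp ⊢
    simp [Finset.card_insert_of_notMem hp.2, hp.1]
  · rintro ⟨T, x⟩ hp
    simp only [Finset.mem_sigma] at hp
    simp [Finset.insert_erase hp.2]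
  · rintro ⟨S, x⟩ hp
    simp only [Finset.mem_sigma, Finset.mem_compl] at hp
    simp [Finset.erase_insert hp.2]
  · intros
    rfl

section SampleMean

variable {ι H : Type*} [NormedAddCommGroup H] [InnerProductSpace ℝ H]

/-- Removing a uniformly random element from `T` multiplies the expectation of
`cosh ‖mean - m‖` by at most `cosh (2 * γ / k)`. -/
lemma sum_cosh_norm_mean_erase_le [DecidableEq ι] {k : ℕ} (hk : 1 ≤ k) {v : ι → H} {γ : ℝ}
    (hv : ∀ i, ‖v i‖ ≤ γ) (m : H) {T : Finset ι} (hT : T.card = k + 1) :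
    ∑ x ∈ T, Real.cosh ‖(k : ℝ)⁻¹ • ∑ i ∈ T.erase x, v i - m‖ ≤
      (k + 1) * (Real.cosh (2 * γ / k) * Real.cosh ‖((k + 1 : ℕ) : ℝ)⁻¹ • ∑ i ∈ T, v i - m‖) := by
  have hk0 : (0 : ℝ) < k := by exact_mod_cast hk
  set A : H := ((k + 1 : ℕ) : ℝ)⁻¹ • ∑ i ∈ T, v i with hA
  have hsum : ∑ i ∈ T, v i = ((k : ℝ) + 1) • A := by
    rw [hA, smul_smul]
    push_cast
    rw [mul_inv_cancel₀ (by positivity), one_smul]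
  have hAn : ‖A‖ ≤ γ := by
    have h1 : ‖∑ i ∈ T, v i‖ ≤ (k + 1) * γ := by
      refine (norm_sum_le_of_le T fun i _ => hv i).trans ?_
      rw [Finset.sum_const, hT, nsmul_eq_mul]
      push_cast
      rfl
    rw [hsum, norm_smul, Real.norm_of_nonneg (by positivity)] at h1
    exact le_of_mul_le_mul_left h1 (by positivity)
  have hpt : ∀ x ∈ T, Real.cosh ‖(k : ℝ)⁻¹ • ∑ i ∈ T.erase x, v i - m‖ ≤
      Real.cosh ‖A - m‖ * Real.cosh (2 * γ / k) +
      Real.sinh ‖A - m‖ * Real.sinh (2 * γ / k) / (‖A - m‖ * (2 * γ / k)) *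
        inner ℝ (A - m) ((k : ℝ)⁻¹ • (A - v x)) := by
    intro x hx
    have he : (k : ℝ)⁻¹ • ∑ i ∈ T.erase x, v i - m = (A - m) + (k : ℝ)⁻¹ • (A - v x) := by
      rw [Finset.sum_erase_eq_sub hx, hsum]
      match_scalars <;> field_simp
    rw [he]
    refine cosh_norm_add_le _ _ ?_
    rw [norm_smul, norm_inv, Real.norm_of_nonneg hk0.le, inv_mul_eq_div]
    gcongr
    linarith [norm_sub_le A (v x), hv x]
  have hzero : ∑ x ∈ T, (k : ℝ)⁻¹ • (A - v x) = 0 := by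
    rw [← Finset.smul_sum, Finset.sum_sub_distrib, hsum, Finset.sum_const, hT,
      ← Nat.cast_smul_eq_nsmul ℝ]
    push_cast
    simp
  refine (Finset.sum_le_sum hpt).trans_eq ?_
  rw [Finset.sum_add_distrib, Finset.sum_const, ← Finset.mul_sum, ← inner_sum, hzero, inner_zero_right, mul_zero,
    add_zero, hT, nsmul_eq_mul]
  push_cast
  ring

variable [Fintype ι]

/-- The total of `cosh ‖mean - m‖` over the `k`-subsets, divided by their number, grows by at most
`cosh (2 * γ / k)` when passing from `k + 1` to `k`. -/
lemma sum_powersetCard_cosh_le {k : ℕ} (hk : 1 ≤ k) (hkN : k < Fintype.card ι) {v : ι → H}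
    {γ : ℝ} (hv : ∀ i, ‖v i‖ ≤ γ) (m : H) :
    (∑ S ∈ Finset.powersetCard k Finset.univ, Real.cosh ‖(k : ℝ)⁻¹ • ∑ i ∈ S, v i - m‖) /
        (Fintype.card ι).choose k ≤
      Real.cosh (2 * γ / k) *
      ((∑ S ∈ Finset.powersetCard (k + 1) Finset.univ,
        Real.cosh ‖((k + 1 : ℕ) : ℝ)⁻¹ • ∑ i ∈ S, v i - m‖) /
          (Fintype.card ι).choose (k + 1)) := by
  classical
  have h := Finset.sum_le_sum fun T hT => sum_cosh_norm_mean_erase_le hk hv m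
    (Finset.mem_powersetCard.1 hT : T ⊆ Finset.univ ∧ T.card = k + 1).2
  rw [sum_powersetCard_succ_sum_erase k
      (fun S => Real.cosh ‖(k : ℝ)⁻¹ • ∑ i ∈ S, v i - m‖),
    ← Finset.mul_sum, ← Finset.mul_sum] at h
  have hch : ((Fintype.card ι).choose (k + 1) : ℝ) * (k + 1) =
      (Fintype.card ι).choose k * (Fintype.card ι - k : ℕ) := by
    exact_mod_cast Nat.choose_succ_right_eq (Fintype.card ι) k
  have hc1 : (0 : ℝ) < (Fintype.card ι).choose k := by
    exact_mod_cast Nat.choose_pos hkN.le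
  have hc2 : (0 : ℝ) < (Fintype.card ι).choose (k + 1) := by
    exact_mod_cast Nat.choose_pos hkN
  have hNk : (0 : ℝ) < (Fintype.card ι - k : ℕ) := by
    exact_mod_cast Nat.sub_pos_of_lt hkN
  rw [← mul_div_assoc, div_le_div_iff₀ hc1 hc2]
  refine le_of_mul_le_mul_left ?_ hNk
  rw [← mul_assoc]
  refine (mul_le_mul_of_nonneg_right h hc2.le).trans_eq ?_
  generalize ∑ S ∈ Finset.powersetCard (k + 1) Finset.univ,
    Real.cosh ‖((k + 1 : ℕ) : ℝ)⁻¹ • ∑ i ∈ S, v i - m‖ = s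
  linear_combination (Real.cosh (2 * γ / k) * s) * hch

/-- Exponential moment bound for the mean of a uniformly random `k`-subset. -/
lemma sum_powersetCard_cosh_le_exp {k : ℕ} (hk : 1 ≤ k) (hkN : k ≤ Fintype.card ι) {v : ι → H}
    {γ : ℝ} (hv : ∀ i, ‖v i‖ ≤ γ) :
    (∑ S ∈ Finset.powersetCard k Finset.univ,
      Real.cosh ‖(k : ℝ)⁻¹ • ∑ i ∈ S, v i - (Fintype.card ι : ℝ)⁻¹ • ∑ i, v i‖) /
        (Fintype.card ι).choose k ≤
      Real.exp (4 * γ ^ 2 * (1 / k - 1 / Fintype.card ι)) := by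
  refine Nat.decreasingInduction' (m := k) (n := Fintype.card ι)
    (P := fun j => (∑ S ∈ Finset.powersetCard j Finset.univ,
      Real.cosh ‖(j : ℝ)⁻¹ • ∑ i ∈ S, v i - (Fintype.card ι : ℝ)⁻¹ • ∑ i, v i‖) /
        (Fintype.card ι).choose j ≤
      Real.exp (4 * γ ^ 2 * (1 / j - 1 / Fintype.card ι))) ?_ hkN ?_
  · intro j hj hkj ih
    have hj0 : (0 : ℝ) < j := by exact_mod_cast hk.trans hkj
    refine (sum_powersetCard_cosh_le (hk.trans hkj) hj hv _).trans ?_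
    refine (mul_le_mul (Real.cosh_le_exp_half_sq _) ih (by positivity)
      (Real.exp_pos _).le).trans ?_
    rw [← Real.exp_add, Real.exp_le_exp]
    have hj1 : (1 : ℝ) ≤ j := by exact_mod_cast hk.trans hkj
    have hid : 4 * γ ^ 2 * (1 / (j : ℝ) - 1 / Fintype.card ι) -
        ((2 * γ / j) ^ 2 / 2 + 4 * γ ^ 2 * (1 / ((j + 1 : ℕ) : ℝ) - 1 / Fintype.card ι)) =
        2 * γ ^ 2 * (j - 1) / (j ^ 2 * (j + 1)) := by
      push_cast
      field_simp
      ring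
    have : 0 ≤ 2 * γ ^ 2 * ((j : ℝ) - 1) / (j ^ 2 * (j + 1)) :=
      div_nonneg (mul_nonneg (by positivity) (by linarith)) (by positivity)
    linarith
  · rw [← Finset.card_univ, Finset.powersetCard_self]
    simp

end SampleMean

/-- Concentration for uniform subsampling without replacement in a Hilbert space:
with probability at least `1 − δ` over a uniformly random size-`M` subset `S`
of `{1, …, N}`, the norm `‖∑ v_n − (N/M) ∑_{i∈S} v_i‖` is at most
`√(8γ²N(N−M+1)/M) · √(2 log(2/δ))`.  The probability is expressed by counting
size-`M` subsets. -/
theorem subsample_concentration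
    {H : Type*} [NormedAddCommGroup H] [InnerProductSpace ℝ H] [CompleteSpace H]
    (N M : ℕ) (hM : 1 ≤ M) (hMN : M ≤ N)
    (v : Fin N → H) (γ : ℝ) (hv : ∀ n, ‖v n‖ ≤ γ)
    (δ : ℝ) (hδ0 : 0 < δ) (hδ1 : δ < 1) :
    (1 - δ) * ((Finset.powersetCard M (Finset.univ : Finset (Fin N))).card : ℝ)
      ≤ (((Finset.powersetCard M (Finset.univ : Finset (Fin N))).filter
          (fun S => ‖(∑ n, v n) - ((N : ℝ) / (M : ℝ)) • ∑ i ∈ S, v i‖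
            ≤ Real.sqrt (8 * γ ^ 2 * N * ((N : ℝ) - M + 1) / M)
              * Real.sqrt (2 * Real.log (2 / δ)))).card : ℝ) := by
  have hN0 : (0 : ℝ) < N := by exact_mod_cast hM.trans hMN
  have hM0 : (0 : ℝ) < M := by exact_mod_cast hM
  have hMN' : (M : ℝ) ≤ N := by exact_mod_cast hMN
  have hγ : 0 ≤ γ := (norm_nonneg _).trans (hv ⟨0, hM.trans hMN⟩)
  set P := Finset.powersetCard M (Finset.univ : Finset (Fin N)) with hP
  set L := Real.log (2 / δ)
  have hL0 : 0 < L := Real.log_pos (by rw [lt_div_iff₀ hδ0]; linarith)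
  rw [← Real.sqrt_mul (div_nonneg (mul_nonneg (by positivity) (by linarith)) hM0.le)]
  set R := Real.sqrt (8 * γ ^ 2 * N * ((N : ℝ) - M + 1) / M * (2 * L)) with hR
  rcases hγ.eq_or_lt with hγ0 | hγ0
  · have hv0 : ∀ n, v n = 0 := fun n => norm_le_zero_iff.1 (hγ0 ▸ hv n)
    rw [Finset.filter_true_of_mem]
    · exact mul_le_of_le_one_left (Nat.cast_nonneg _) (by linarith)
    · intro S _
      simp [hv0, hR]
  have hR2 : R ^ 2 = 8 * γ ^ 2 * N * ((N : ℝ) - M + 1) / M * (2 * L) :=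
    Real.sq_sqrt (mul_nonneg (div_nonneg (mul_nonneg (by positivity) (by linarith)) hM0.le)
      (by positivity))
  have hNM : 0 < (N : ℝ) - M + 1 := by linarith
  -- the optimal exponent for the mean, whose deviation is `R / N`
  set l := R / N / (8 * γ ^ 2 * ((N : ℝ) - M + 1) / (N * M)) with hl
  have hl0 : 0 ≤ l := by positivity
  have hlR : l * (R / N) = 2 * L := by
    have : l * (R / N) = R ^ 2 * (M / (8 * γ ^ 2 * ((N : ℝ) - M + 1) * N)) := by
      rw [hl]; field_simp
    rw [this, hR2]; field_simp
  have hl2 : 4 * (l * γ) ^ 2 * (1 / M - 1 / N) ≤ L := by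
    have h1 : 4 * (l * γ) ^ 2 * (((N : ℝ) - M + 1) / (N * M)) = L := by
      have : 4 * (l * γ) ^ 2 * (((N : ℝ) - M + 1) / (N * M)) = l * (R / N) / 2 := by
        rw [hl]; field_simp; ring
      rw [this, hlR]; ring
    rw [← h1]
    gcongr
    rw [div_sub_div _ _ hM0.ne' hN0.ne', mul_comm (N : ℝ) M]
    gcongr
    linarith
  have hmoment := sum_powersetCard_cosh_le_exp (ι := Fin N) (v := fun i => l • v i) hM
    (by simpa using hMN) (γ := l * γ) (fun i => by
      rw [norm_smul, Real.norm_of_nonneg hl0]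
      exact mul_le_mul_of_nonneg_left (hv i) hl0)
  rw [Fintype.card_fin] at hmoment
  have hcard : (P.card : ℝ) = N.choose M := by
    rw [hP, Finset.card_powersetCard, Finset.card_univ, Fintype.card_fin]
  have hcard0 : (0 : ℝ) < P.card := by
    rw [hcard]; exact_mod_cast Nat.choose_pos hMN
  rw [← hcard, div_le_iff₀ hcard0, ← hP] at hmoment
  set B := P.filter fun S => ¬ ‖(∑ n, v n) - ((N : ℝ) / (M : ℝ)) • ∑ i ∈ S, v i‖ ≤ R
  have hmarkov : (B.card : ℝ) * (Real.exp (2 * L) / 2) ≤ Real.exp L * P.card := by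
    calc (B.card : ℝ) * (Real.exp (2 * L) / 2) = ∑ S ∈ B, Real.exp (2 * L) / 2 := by
          rw [Finset.sum_const, nsmul_eq_mul]
      _ ≤ ∑ S ∈ B, Real.cosh ‖(M : ℝ)⁻¹ • ∑ i ∈ S, l • v i - (N : ℝ)⁻¹ • ∑ i, l • v i‖ := by
          refine Finset.sum_le_sum fun S hS => ?_
          have hS' := not_le.1 (Finset.mem_filter.1 hS).2
          have he : (M : ℝ)⁻¹ • ∑ i ∈ S, l • v i - (N : ℝ)⁻¹ • ∑ i, l • v i =
              -((l / N) • ((∑ n, v n) - ((N : ℝ) / (M : ℝ)) • ∑ i ∈ S, v i)) := by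
            rw [← Finset.smul_sum, ← Finset.smul_sum]
            match_scalars <;> field_simp
          rw [he, norm_neg, norm_smul, Real.norm_of_nonneg (by positivity)]
          have hle : 2 * L ≤
              l / N * ‖(∑ n, v n) - ((N : ℝ) / (M : ℝ)) • ∑ i ∈ S, v i‖ := by
            rw [← hlR, mul_div_assoc', ← div_mul_eq_mul_div]
            gcongr
          rw [Real.cosh_eq]
          have := Real.exp_le_exp.2 hle
          have := Real.exp_pos
            (-(l / N * ‖(∑ n, v n) - ((N : ℝ) / (M : ℝ)) • ∑ i ∈ S, v i‖))
          linarith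
      _ ≤ ∑ S ∈ P, Real.cosh ‖(M : ℝ)⁻¹ • ∑ i ∈ S, l • v i - (N : ℝ)⁻¹ • ∑ i, l • v i‖ :=
          Finset.sum_le_sum_of_subset_of_nonneg (Finset.filter_subset _ _)
            fun _ _ _ => (Real.cosh_pos _).le
      _ ≤ _ := hmoment
      _ ≤ Real.exp L * P.card := by gcongr
  have hbad : (B.card : ℝ) ≤ δ * P.card := by
    have hexp : Real.exp L = 2 / δ := Real.exp_log (by positivity)
    have h2 : Real.exp (2 * L) = 2 / δ * (2 / δ) := by rw [two_mul, Real.exp_add, hexp]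
    rw [h2, hexp] at hmarkov
    have h3 : (B.card : ℝ) / δ ≤ P.card := by
      refine le_of_mul_le_mul_left ?_ (by positivity : 0 < 2 / δ)
      calc _ = (B.card : ℝ) * (2 / δ * (2 / δ) / 2) := by field_simp
        _ ≤ _ := hmarkov
    rw [div_le_iff₀ hδ0] at h3
    linarith
  have hsplit := Finset.card_filter_add_card_filter_not (s := P)
    (fun S => ‖(∑ n, v n) - ((N : ℝ) / (M : ℝ)) • ∑ i ∈ S, v i‖ ≤ R)
  have hsplit' : ((P.filter fun S =>
      ‖(∑ n, v n) - ((N : ℝ) / (M : ℝ)) • ∑ i ∈ S, v i‖ ≤ R).card : ℝ) + B.card = P.card := by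
    exact_mod_cast hsplit
  linarith
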